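/- arXiv:2502.18019 — 9 statements merged into one kernel-verified Lean document; each statement's English description precedes it below -/
import Mathlib

section
/- For all n ∈ ℕ with n ≥ 1 and all x ∈ [0,1]^n, F_n(x) ≤ F_n(e^n); that is, the maximum of F_n over the hypercube [0,1]^n is attained at the unit vector e^n. -/
open Finset

/-- `alphaF n x i` is the recursively defined `α_{n,i}(x)`:
`α_{n,n+1}(x) = 0` and `α_{n,i}(x) = x_i + (1 - 2 x_i) α_{n,i+1}(x)` for `i = 1, …, n`. -/
noncomputable def alphaF (n : ℕ) (x : ℕ → ℝ) (i : ℕ) : ℝ :=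
  if h : n + 1 ≤ i then 0 else x i + (1 - 2 * x i) * alphaF n x (i + 1)
termination_by n + 1 - i
decreasing_by omega

/-- `betaF n x i = 2^i (x_i - x_i²)(1 - x_{i-1} + Σ_{j=1}^{i-2} x_j)`, with `x_0 := 1`. -/
noncomputable def betaF (n : ℕ) (x : ℕ → ℝ) (i : ℕ) : ℝ :=
  (2 : ℝ) ^ i * (x i - x i ^ 2) *
    (1 - (if i = 1 then 1 else x (i - 1)) + ∑ j ∈ Finset.Icc 1 (i - 2), x j)

/-- `Ffun n x = Σ_{i=1}^n (2^{i-1} α_{n,i}(x) - β_{n,i}(x))`. -/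
noncomputable def Ffun (n : ℕ) (x : ℕ → ℝ) : ℝ :=
  ∑ i ∈ Finset.Icc 1 n, ((2 : ℝ) ^ (i - 1) * alphaF n x i - betaF n x i)

/-- `partialF n k x` is the partial derivative `∂_k F_n(x)`. -/
noncomputable def partialF (n k : ℕ) (x : ℕ → ℝ) : ℝ :=
  deriv (fun t => Ffun n (Function.update x k t)) (x k)

/-- `partialAlpha n k i x` is the partial derivative `∂_k α_{n,i}(x)`. -/
noncomputable def partialAlpha (n k i : ℕ) (x : ℕ → ℝ) : ℝ :=
  deriv (fun t => alphaF n (Function.update x k t) i) (x k)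

/-- `Pfun n x k = x_{k-1} ∏_{j=1}^{k-2} (1 - x_j)`, with `x_0 := 1`. -/
noncomputable def Pfun (n : ℕ) (x : ℕ → ℝ) (k : ℕ) : ℝ :=
  (if k = 1 then 1 else x (k - 1)) * ∏ j ∈ Finset.Icc 1 (k - 2), (1 - x j)

/-- `Sfun n x k = Σ_{j=k+1}^n x_j`. -/
noncomputable def Sfun (n : ℕ) (x : ℕ → ℝ) (k : ℕ) : ℝ :=
  ∑ j ∈ Finset.Icc (k + 1) n, x j

/-- Two real numbers (which will take integer values) have the same parity. -/
def SameParity (a b : ℝ) : Prop := ∃ m : ℤ, a - b = 2 * (m : ℝ)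

/-- The `k`-th standard unit vector, as a function `ℕ → ℝ` (coordinates `1, …, n`). -/
noncomputable def unitVec (k : ℕ) : ℕ → ℝ := fun i => if i = k then 1 else 0

lemma alphaF_mem (n : ℕ) (x : ℕ → ℝ)
    (hx : ∀ i ∈ Finset.Icc 1 n, 0 ≤ x i ∧ x i ≤ 1) (d : ℕ) :
    ∀ i, 1 ≤ i → n + 1 - i = d → 0 ≤ alphaF n x i ∧ alphaF n x i ≤ 1 := by
  induction d with
  | zero =>
    intro i hi h
    rw [alphaF, dif_pos (by omega)]
    norm_num
  | succ d ih =>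
    intro i hi h
    rw [alphaF, dif_neg (by omega)]
    obtain ⟨h0, h1⟩ := ih (i + 1) (by omega) (by omega)
    obtain ⟨a0, a1⟩ := hx i (Finset.mem_Icc.2 ⟨hi, by omega⟩)
    constructor <;> nlinarith [mul_nonneg h0 a0, mul_nonneg (sub_nonneg.2 h1) a0,
      mul_nonneg h0 (sub_nonneg.2 a1), mul_nonneg (sub_nonneg.2 h1) (sub_nonneg.2 a1)]

lemma betaF_nonneg' (n : ℕ) (x : ℕ → ℝ)
    (hx : ∀ i ∈ Finset.Icc 1 n, 0 ≤ x i ∧ x i ≤ 1) (i : ℕ) (hi : i ∈ Finset.Icc 1 n) :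
    0 ≤ betaF n x i := by
  unfold betaF
  obtain ⟨a0, a1⟩ := hx i hi
  rw [Finset.mem_Icc] at hi
  have hs : 0 ≤ ∑ j ∈ Finset.Icc 1 (i - 2), x j := by
    apply Finset.sum_nonneg
    intro j hj
    rw [Finset.mem_Icc] at hj
    exact (hx j (Finset.mem_Icc.2 ⟨hj.1, by omega⟩)).1
  have hp : (if i = 1 then 1 else x (i - 1)) ≤ (1 : ℝ) := by
    split_ifs with h
    · exact le_refl _
    · exact (hx (i - 1) (Finset.mem_Icc.2 ⟨by omega, by omega⟩)).2
  apply mul_nonneg (mul_nonneg (by positivity) (by nlinarith)) (by linarith)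

lemma alphaF_unit (n : ℕ) (d : ℕ) :
    ∀ i, i ≤ n → n - i = d → alphaF n (unitVec n) i = 1 := by
  induction d with
  | zero =>
    intro i hi h
    have : i = n := by omega
    subst this
    rw [alphaF, dif_neg (by omega), alphaF, dif_pos (by omega)]
    simp [unitVec]
  | succ d ih =>
    intro i hi h
    rw [alphaF, dif_neg (by omega), ih (i + 1) (by omega) (by omega)]
    have : i ≠ n := by omega
    simp [unitVec, this]

lemma betaF_unit (n i : ℕ) : betaF n (unitVec n) i = 0 := by
  have : unitVec n i - unitVec n i ^ 2 = 0 := by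
    unfold unitVec
    split_ifs <;> norm_num
  simp [betaF, this]

theorem stmt0 (n : ℕ) (hn : 1 ≤ n) (x : ℕ → ℝ)
    (hx : ∀ i ∈ Finset.Icc 1 n, 0 ≤ x i ∧ x i ≤ 1) :
    Ffun n x ≤ Ffun n (unitVec n) := by
  unfold Ffun
  apply Finset.sum_le_sum
  intro i hi
  have hb := betaF_nonneg' n x hx i hi
  rw [Finset.mem_Icc] at hi
  rw [alphaF_unit n _ i hi.2 rfl, betaF_unit]
  have ha := (alphaF_mem n x hx _ i hi.1 rfl).2
  have := mul_le_mul_of_nonneg_left ha (by positivity : (0 : ℝ) ≤ 2 ^ (i - 1))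
  linarith
end

section
/- For all n ∈ ℕ with n ≥ 1 and all x ∈ [0,1]^n, one has α_{n,i}(x) = 1 for every i ∈ {1,…,n} if and only if x = e^n. -/
open Finset

theorem stmt1 (n : ℕ) (hn : 1 ≤ n) (x : ℕ → ℝ)
    (hx : ∀ i ∈ Finset.Icc 1 n, 0 ≤ x i ∧ x i ≤ 1) :
    (∀ i ∈ Finset.Icc 1 n, alphaF n x i = 1) ↔ (∀ i ∈ Finset.Icc 1 n, x i = unitVec n i) := by
  have hend : alphaF n x (n + 1) = 0 := by
    rw [alphaF]; simp
  have hrec : ∀ i, i ≤ n → alphaF n x i = x i + (1 - 2 * x i) * alphaF n x (i + 1) := by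
    intro i hi
    rw [alphaF, dif_neg (by omega)]
  constructor
  · intro h i hi
    have h1 := h i hi
    have hi' := Finset.mem_Icc.mp hi
    rw [hrec i hi'.2] at h1
    unfold unitVec
    by_cases hin : i = n
    · subst hin
      rw [hend] at h1
      rw [if_pos rfl]
      linarith
    · rw [if_neg hin]
      rw [h (i + 1) (Finset.mem_Icc.mpr ⟨by omega, by omega⟩)] at h1
      linarith
  · intro h
    have key : ∀ k, k < n → alphaF n x (n - k) = 1 := by
      intro k
      induction k with
      | zero =>
        intro _
        have hxn := h n (Finset.mem_Icc.mpr ⟨hn, le_rfl⟩)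
        simp only [unitVec, if_true] at hxn
        rw [Nat.sub_zero, hrec n le_rfl, hend, hxn]
        norm_num
      | succ k ih =>
        intro hk
        have hxk := h (n - (k + 1)) (Finset.mem_Icc.mpr ⟨by omega, by omega⟩)
        rw [unitVec, if_neg (by omega)] at hxk
        have e : n - (k + 1) + 1 = n - k := by omega
        rw [hrec _ (by omega), e, ih (by omega), hxk]
        norm_num
    intro i hi
    have hi' := Finset.mem_Icc.mp hi
    have := key (n - i) (by omega)
    rwa [Nat.sub_sub_self hi'.2] at this
end

section
/- For all n ∈ ℕ, all k ∈ {1,…,n}, and all x ∈ {0,1}^n, the k-th partial derivative of F_n at x equals ∂_k F_n(x) = (1 − 2α_{n,k+1}(x)) · Σ_{i=1}^k 2^{i−1} ∏_{j=i}^{k−1}(1 − 2x_j) − 2^k (1 − 2x_k)(1 − x_{k−1} + Σ_{i=1}^{k−2} x_i), where x_0 := 1 (in particular ∂_1 F_n(x) = 1 − 2α_{n,2}(x)). -/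
open Finset

theorem alphaF_upd (n k : ℕ) (x : ℕ → ℝ) (t : ℝ) (d : ℕ) : ∀ i, k < i → n + 1 - i = d →
    alphaF n (Function.update x k t) i = alphaF n x i := by
  induction d with
  | zero =>
    intro i hi hd
    rw [alphaF, alphaF.eq_1 n x, dif_pos (by omega), dif_pos (by omega)]
  | succ d ih =>
    intro i hi hd
    rw [alphaF, alphaF.eq_1 n x, dif_neg (by omega), dif_neg (by omega),
      ih (i + 1) (by omega) (by omega), Function.update_of_ne (by omega)]

theorem alphaF_deriv (n k : ℕ) (hkn : k ≤ n) (x : ℕ → ℝ) (d : ℕ) : ∀ i, i + d = k →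
    HasDerivAt (fun t => alphaF n (Function.update x k t) i)
      ((1 - 2 * alphaF n x (k + 1)) * ∏ j ∈ Finset.Icc i (k - 1), (1 - 2 * x j)) (x k) ∨ i = 0 := by
  induction d with
  | zero =>
    intro i hi
    obtain rfl : i = k := by omega
    by_cases h0 : i = 0
    · exact Or.inr h0
    left
    have e : (fun t => alphaF n (Function.update x i t) i) =
        fun t => t + (1 - 2 * t) * alphaF n x (i + 1) := by
      funext t
      rw [alphaF, dif_neg (by omega), alphaF_upd n i x t _ (i + 1) (by omega) rfl,
        Function.update_self]
    rw [e, Finset.Icc_eq_empty (by omega), Finset.prod_empty]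
    have h := (hasDerivAt_id (x i)).add
      ((((hasDerivAt_id (x i)).const_mul 2).const_sub 1).mul_const (alphaF n x (i + 1)))
    refine HasDerivAt.congr_deriv h ?_
    ring
  | succ d ih =>
    intro i hi
    by_cases h0 : i = 0
    · exact Or.inr h0
    left
    have e : (fun t => alphaF n (Function.update x k t) i) =
        fun t => x i + (1 - 2 * x i) * alphaF n (Function.update x k t) (i + 1) := by
      funext t
      rw [alphaF, dif_neg (by omega), Function.update_of_ne (by omega)]
    rw [e]
    have h := (((ih (i + 1) (by omega)).resolve_right (by omega)).const_mul
      (1 - 2 * x i)).const_add (x i)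
    refine HasDerivAt.congr_deriv h ?_
    rw [← Finset.mul_prod_Ioc_eq_prod_Icc (by omega : i ≤ k - 1), ← Finset.Icc_add_one_left_eq_Ioc]
    ring

theorem betaF_deriv (n k : ℕ) (hk1 : 1 ≤ k) (x : ℕ → ℝ) :
    HasDerivAt (fun t => betaF n (Function.update x k t) k)
      ((2 : ℝ) ^ k * (1 - 2 * x k) *
        (1 - (if k = 1 then 1 else x (k - 1)) + ∑ i ∈ Finset.Icc 1 (k - 2), x i)) (x k) := by
  have e : (fun t => betaF n (Function.update x k t) k) = fun t => (2 : ℝ) ^ k * (t - t ^ 2) *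
        (1 - (if k = 1 then 1 else x (k - 1)) + ∑ i ∈ Finset.Icc 1 (k - 2), x i) := by
    funext t
    rw [betaF, Function.update_self, Function.update_of_ne (by omega)]
    congr 2
    refine Finset.sum_congr rfl fun j hj => ?_
    rw [Finset.mem_Icc] at hj
    rw [Function.update_of_ne (by omega)]
  rw [e]
  have h := (((hasDerivAt_id (x k)).sub ((hasDerivAt_id (x k)).pow 2)).const_mul
    ((2 : ℝ) ^ k)).mul_const
    (1 - (if k = 1 then 1 else x (k - 1)) + ∑ i ∈ Finset.Icc 1 (k - 2), x i)
  refine HasDerivAt.congr_deriv h ?_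
  simp

theorem stmt4 (n k : ℕ) (hk : k ∈ Finset.Icc 1 n) (x : ℕ → ℝ)
    (hx : ∀ i ∈ Finset.Icc 1 n, x i = 0 ∨ x i = 1) :
    partialF n k x =
      (1 - 2 * alphaF n x (k + 1)) *
        (∑ i ∈ Finset.Icc 1 k, (2 : ℝ) ^ (i - 1) * ∏ j ∈ Finset.Icc i (k - 1), (1 - 2 * x j))
      - (2 : ℝ) ^ k * (1 - 2 * x k) *
        (1 - (if k = 1 then 1 else x (k - 1)) + ∑ i ∈ Finset.Icc 1 (k - 2), x i) := by
  obtain ⟨hk1, hkn⟩ := Finset.mem_Icc.1 hk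
  set B := (2 : ℝ) ^ k * (1 - 2 * x k) *
        (1 - (if k = 1 then 1 else x (k - 1)) + ∑ i ∈ Finset.Icc 1 (k - 2), x i) with hB
  have key : ∀ i ∈ Finset.Icc 1 n, HasDerivAt
      (fun t => (2 : ℝ) ^ (i - 1) * alphaF n (Function.update x k t) i
        - betaF n (Function.update x k t) i)
      ((if i ≤ k then (1 - 2 * alphaF n x (k + 1)) *
        ((2 : ℝ) ^ (i - 1) * ∏ j ∈ Finset.Icc i (k - 1), (1 - 2 * x j)) else 0)
        - (if i = k then B else 0)) (x k) := by
    intro i hi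
    have hi' := Finset.mem_Icc.1 hi
    apply HasDerivAt.sub
    · split_ifs with h
      · have h1 := ((alphaF_deriv n k hkn x (k - i) i (by omega)).resolve_right
          (by omega)).const_mul ((2 : ℝ) ^ (i - 1))
        refine HasDerivAt.congr_deriv h1 ?_
        ring
      · have e : (fun t => (2 : ℝ) ^ (i - 1) * alphaF n (Function.update x k t) i) =
            fun _ => (2 : ℝ) ^ (i - 1) * alphaF n x i := by
          funext t
          rw [alphaF_upd n k x t _ i (by omega) rfl]
        rw [e]
        exact hasDerivAt_const _ _
    · split_ifs with h
      · subst h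
        exact betaF_deriv n i hk1 x
      · have e : (fun t => betaF n (Function.update x k t) i) = fun _ => 0 := by
          funext t
          have : x i - x i ^ 2 = 0 := by
            rcases hx i hi with h | h <;> rw [h] <;> norm_num
          rw [betaF, Function.update_of_ne h, this]
          ring
        rw [e]
        exact hasDerivAt_const _ _
  have hs := (HasDerivAt.fun_sum key).deriv
  unfold partialF Ffun
  rw [hs, Finset.sum_sub_distrib, Finset.sum_ite_eq', if_pos hk, ← Finset.sum_filter,
    Finset.mul_sum]
  congr 2
  ext i
  simp only [Finset.mem_filter, Finset.mem_Icc]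
  omega
end

section
/- For all n ∈ ℕ, all k ∈ {1,…,n}, and all x ∈ {0,1}^n: α_{n,k+1}(x) = 0 if S_n(x,k) is even, and α_{n,k+1}(x) = 1 if S_n(x,k) is odd; in particular α_{n,k+1}(x) has the same parity as S_n(x,k). -/
open Finset

theorem stmt7_aux (n : ℕ) (x : ℕ → ℝ) (hx : ∀ i ∈ Finset.Icc 1 n, x i = 0 ∨ x i = 1) :
    ∀ d k : ℕ, n - k = d →
      (alphaF n x (k + 1) = 0 ∨ alphaF n x (k + 1) = 1) ∧
      SameParity (alphaF n x (k + 1)) (Sfun n x k) := by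
  intro d
  induction d with
  | zero =>
    intro k hd
    have h1 : alphaF n x (k + 1) = 0 := by
      rw [alphaF, dif_pos (by omega)]
    have h2 : Sfun n x k = 0 := by
      unfold Sfun
      rw [Finset.Icc_eq_empty (by omega)]
      simp
    exact ⟨Or.inl h1, 0, by rw [h1, h2]; simp⟩
  | succ d ih =>
    intro k hd
    obtain ⟨h1, m, hm⟩ := ih (k + 1) (by omega)
    have h2 : alphaF n x (k + 1)
        = x (k + 1) + (1 - 2 * x (k + 1)) * alphaF n x (k + 1 + 1) := by
      rw [alphaF, dif_neg (by omega)]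
    have h3 : Sfun n x k = x (k + 1) + Sfun n x (k + 1) := by
      unfold Sfun
      rw [← Finset.add_sum_Ioc_eq_sum_Icc (by omega)]
      have h5 : Finset.Ioc (k + 1) n = Finset.Icc (k + 1 + 1) n := by
        ext j
        simp only [Finset.mem_Ioc, Finset.mem_Icc]
        omega
      rw [h5]
    have h4 := hx (k + 1) (by simp; omega)
    unfold SameParity
    rw [h2, h3]
    rcases h4 with h4 | h4 <;> rcases h1 with h1 | h1 <;> rw [h4, h1] <;> rw [h1] at hm
    · exact ⟨by norm_num, m, by linarith⟩
    · exact ⟨by norm_num, m, by linarith⟩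
    · exact ⟨by norm_num, m, by linarith⟩
    · exact ⟨by norm_num, m - 1, by push_cast; linarith⟩

theorem stmt7 (n k : ℕ) (hk : k ∈ Finset.Icc 1 n) (x : ℕ → ℝ)
    (hx : ∀ i ∈ Finset.Icc 1 n, x i = 0 ∨ x i = 1) :
    ((∃ m : ℤ, Sfun n x k = 2 * (m : ℝ)) → alphaF n x (k + 1) = 0) ∧
    ((∃ m : ℤ, Sfun n x k = 2 * (m : ℝ) + 1) → alphaF n x (k + 1) = 1) ∧
    SameParity (alphaF n x (k + 1)) (Sfun n x k) := by
  obtain ⟨h1, h2⟩ := stmt7_aux n x hx _ k rfl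
  refine ⟨?_, ?_, h2⟩
  · rintro ⟨m, hm⟩
    obtain ⟨l, hl⟩ := h2
    rcases h1 with h1 | h1
    · exact h1
    · exfalso
      rw [h1, hm] at hl
      have : (1 : ℤ) - 2 * m = 2 * l := by exact_mod_cast hl
      omega
  · rintro ⟨m, hm⟩
    obtain ⟨l, hl⟩ := h2
    rcases h1 with h1 | h1
    · exfalso
      rw [h1, hm] at hl
      have : (0 : ℤ) - (2 * m + 1) = 2 * l := by exact_mod_cast hl
      omega
    · exact h1
end

section
/- For all n ∈ ℕ, all x ∈ {0,1}^n, and all k ∈ {1,…,n}, the following are equivalent: (i) either ∂_k F_n(x) > 0 and x_k = 0, or ∂_k F_n(x) < 0 and x_k = 1; (ii) S_n(x,k) has the same parity as x_k, and P_n(x,k) = 1. -/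
open Finset

noncomputable def WW (x : ℕ → ℝ) (k : ℕ) : ℝ :=
  ∑ i ∈ Finset.Icc 1 k, (2 : ℝ) ^ (i - 1) * ∏ j ∈ Finset.Ico i k, (1 - 2 * x j)

lemma WW_one (x : ℕ → ℝ) : WW x 1 = 1 := by simp [WW]

lemma WW_succ (x : ℕ → ℝ) (k : ℕ) : WW x (k+1) = (1 - 2 * x k) * WW x k + 2 ^ k := by
  unfold WW
  rw [Finset.sum_Icc_succ_top (by omega), Finset.mul_sum]
  congr 1
  · refine Finset.sum_congr rfl fun i hi => ?_
    rw [Finset.mem_Icc] at hi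
    rw [Finset.prod_Ico_succ_top hi.2]
    ring
  · simp

lemma WW_bound (x : ℕ → ℝ) (k : ℕ) (hk : 1 ≤ k)
    (hx : ∀ i, 1 ≤ i → i < k → x i = 0 ∨ x i = 1) : |WW x k| ≤ 2 ^ k - 1 := by
  induction k, hk using Nat.le_induction with
  | base => rw [WW_one]; norm_num
  | succ k hk ih =>
    have h := abs_le.1 (ih fun i h1 h2 => hx i h1 (by omega))
    rw [WW_succ, abs_le, pow_succ]
    rcases hx k hk (by omega) with h0 | h0 <;> rw [h0] <;> constructor <;> linarith [h.1, h.2]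

lemma WW_zero (x : ℕ → ℝ) (k : ℕ) (hk : 1 ≤ k)
    (hx : ∀ i, 1 ≤ i → i < k → x i = 0) : WW x k = 2 ^ k - 1 := by
  induction k, hk using Nat.le_induction with
  | base => rw [WW_one]; norm_num
  | succ k hk ih =>
    rw [WW_succ, ih fun i h1 h2 => hx i h1 (by omega), hx k hk (by omega), pow_succ]
    ring

noncomputable def CC (x : ℕ → ℝ) (i : ℕ) : ℝ :=
  (1 - (if i = 1 then 1 else x (i - 1)) + ∑ j ∈ Finset.Icc 1 (i - 2), x j)

lemma CC_cases (n : ℕ) (x : ℕ → ℝ) (k : ℕ) (hk : 1 ≤ k)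
    (hx : ∀ i, 1 ≤ i → i < k → x i = 0 ∨ x i = 1) :
    (Pfun n x k = 1 ∧ CC x k = 0 ∧ WW x k = 1) ∨ (Pfun n x k ≠ 1 ∧ 1 ≤ CC x k) := by
  obtain rfl | ⟨m, rfl⟩ : k = 1 ∨ ∃ m, k = m + 2 := by
    rcases k with _ | _ | m
    · omega
    · simp
    · right; exact ⟨m, rfl⟩
  · left; simp [Pfun, CC, WW_one]
  have hnn : ∀ j ∈ Finset.Icc 1 m, 0 ≤ x j := by
    intro j hj
    rw [Finset.mem_Icc] at hj
    rcases hx j hj.1 (by omega) with h | h <;> rw [h] <;> norm_num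
  have hP : Pfun n x (m+2) = x (m+1) * ∏ j ∈ Finset.Icc 1 m, (1 - x j) := by simp [Pfun]
  have hC : CC x (m+2) = 1 - x (m+1) + ∑ j ∈ Finset.Icc 1 m, x j := by simp [CC]
  have hs := Finset.sum_nonneg hnn
  rw [hP, hC]
  rcases hx (m+1) (by omega) (by omega) with h | h
  · right; rw [h]; constructor
    · simp
    · linarith
  · rw [h]
    by_cases hz : ∀ j ∈ Finset.Icc 1 m, x j = 0
    · left
      refine ⟨?_, ?_, ?_⟩
      · rw [one_mul]; exact Finset.prod_eq_one fun j hj => by rw [hz j hj]; norm_num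
      · rw [Finset.sum_eq_zero hz]; norm_num
      · rw [WW_succ, h, WW_zero x (m+1) (by omega)
          fun i h1 h2 => hz i (Finset.mem_Icc.2 ⟨h1, by omega⟩)]
        ring
    · right
      push Not at hz
      obtain ⟨j, hj, hj0⟩ := hz
      have hj' := Finset.mem_Icc.1 hj
      have h1 : x j = 1 := (hx j hj'.1 (by omega)).resolve_left hj0
      constructor
      · rw [Finset.prod_eq_zero hj (by rw [h1]; norm_num)]; norm_num
      · have := Finset.single_le_sum hnn hj
        linarith

lemma alpha_par (n : ℕ) (x : ℕ → ℝ) (hx : ∀ i ∈ Finset.Icc 1 n, x i = 0 ∨ x i = 1) (d : ℕ) :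
    ∀ i, 1 ≤ i → n + 1 - i = d →
    (alphaF n x i = 0 ∧ ∃ m : ℤ, ∑ j ∈ Finset.Icc i n, x j = 2 * m) ∨
    (alphaF n x i = 1 ∧ ∃ m : ℤ, ∑ j ∈ Finset.Icc i n, x j = 2 * m + 1) := by
  induction d with
  | zero =>
    intro i _ hd
    left
    rw [alphaF, dif_pos (by omega), Finset.Icc_eq_empty (by omega)]
    exact ⟨rfl, 0, by simp⟩
  | succ d ih =>
    intro i h1 hd
    have e : ∑ j ∈ Finset.Icc i n, x j = x i + ∑ j ∈ Finset.Icc (i+1) n, x j := by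
      rw [← Finset.add_sum_Ioc_eq_sum_Icc (by omega)]
      congr 2
      ext j; simp only [Finset.mem_Ioc, Finset.mem_Icc]; omega
    rw [alphaF, dif_neg (by omega), e]
    rcases ih (i+1) (by omega) (by omega) with ⟨ha, m, hm⟩ | ⟨ha, m, hm⟩ <;>
    rcases hx i (Finset.mem_Icc.2 ⟨h1, by omega⟩) with h | h <;> rw [ha, hm, h]
    · left; exact ⟨by norm_num, m, by ring⟩
    · right; exact ⟨by norm_num, m, by ring⟩
    · right; exact ⟨by norm_num, m, by ring⟩
    · left; exact ⟨by norm_num, m + 1, by push_cast; ring⟩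

lemma alpha_upd (n : ℕ) (x : ℕ → ℝ) (k : ℕ) (t : ℝ) (d : ℕ) :
    ∀ i, k < i → n + 1 - i = d → alphaF n (Function.update x k t) i = alphaF n x i := by
  induction d with
  | zero =>
    intro i _ hd
    rw [alphaF, dif_pos (by omega), alphaF, dif_pos (by omega)]
  | succ d ih =>
    intro i h1 hd
    rw [alphaF, dif_neg (by omega), ih (i+1) (by omega) (by omega),
      Function.update_of_ne (by omega)]
    conv_rhs => rw [alphaF, dif_neg (by omega)]

lemma alpha_deriv (n : ℕ) (x : ℕ → ℝ) (k : ℕ) (hk : k ≤ n) (d : ℕ) :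
    ∀ i, i ≤ k → k - i = d → HasDerivAt (fun t => alphaF n (Function.update x k t) i)
      ((∏ j ∈ Finset.Ico i k, (1 - 2 * x j)) * (1 - 2 * alphaF n x (k+1))) (x k) := by
  induction d with
  | zero =>
    intro i h1 hd
    obtain rfl : i = k := by omega
    have : (fun t => alphaF n (Function.update x i t) i) =
        fun t => t + (1 - 2 * t) * alphaF n x (i+1) := by
      funext t
      rw [alphaF, dif_neg (by omega), alpha_upd n x i t _ (i+1) (by omega) rfl]
      simp
    rw [this]
    have h := (hasDerivAt_id (x i)).add
      ((((hasDerivAt_id (x i)).const_mul 2).const_sub 1).mul_const (alphaF n x (i+1)))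
    refine h.congr_deriv ?_
    simp; ring
  | succ d ih =>
    intro i h1 hd
    have : (fun t => alphaF n (Function.update x k t) i) =
        fun t => x i + (1 - 2 * x i) * alphaF n (Function.update x k t) (i+1) := by
      funext t
      rw [alphaF, dif_neg (by omega), Function.update_of_ne (by omega)]
    rw [this, Finset.prod_eq_prod_Ico_succ_bot (by omega), mul_assoc]
    exact ((ih (i+1) (by omega) (by omega)).const_mul _).const_add _

lemma beta_deriv (n : ℕ) (x : ℕ → ℝ) (hx : ∀ i ∈ Finset.Icc 1 n, x i = 0 ∨ x i = 1)
    (k i : ℕ) (hi : i ∈ Finset.Icc 1 n) : HasDerivAt (fun t => betaF n (Function.update x k t) i)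
      (if i = k then 2 ^ k * (1 - 2 * x k) * CC x k else 0) (x k) := by
  have hi' := Finset.mem_Icc.1 hi
  split_ifs with h
  · subst h
    have : (fun t => betaF n (Function.update x i t) i) =
        fun t => 2 ^ i * (t - t ^ 2) * CC x i := by
      funext t
      unfold betaF CC
      have e : ∑ j ∈ Finset.Icc 1 (i-2), Function.update x i t j =
          ∑ j ∈ Finset.Icc 1 (i-2), x j := by
        refine Finset.sum_congr rfl fun j hj => ?_
        rw [Finset.mem_Icc] at hj
        rw [Function.update_of_ne (by omega)]
      rw [e, Function.update_self, Function.update_of_ne (by omega)]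
    rw [this]
    have h := ((((hasDerivAt_id (x i)).sub ((hasDerivAt_id (x i)).pow 2)).const_mul
      ((2:ℝ) ^ i))).mul_const (CC x i)
    refine h.congr_deriv ?_
    simp
  · have : (fun t => betaF n (Function.update x k t) i) = fun t => 0 := by
      funext t
      unfold betaF
      rw [Function.update_of_ne h]
      rcases hx i hi with h | h <;> rw [h] <;> simp
    rw [this]
    exact hasDerivAt_const _ _

lemma partialF_eq (n k : ℕ) (hk : k ∈ Finset.Icc 1 n) (x : ℕ → ℝ)
    (hx : ∀ i ∈ Finset.Icc 1 n, x i = 0 ∨ x i = 1) :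
    partialF n k x = (1 - 2 * alphaF n x (k+1)) * WW x k - 2 ^ k * (1 - 2 * x k) * CC x k := by
  have hk' := Finset.mem_Icc.1 hk
  have key : ∀ i ∈ Finset.Icc 1 n, HasDerivAt
      (fun t => (2:ℝ) ^ (i-1) * alphaF n (Function.update x k t) i
        - betaF n (Function.update x k t) i)
      ((if i ≤ k then (1 - 2 * alphaF n x (k+1)) *
        (2 ^ (i-1) * ∏ j ∈ Finset.Ico i k, (1 - 2 * x j)) else 0) -
        (if i = k then 2 ^ k * (1 - 2 * x k) * CC x k else 0)) (x k) := by
    intro i hi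
    refine HasDerivAt.sub ?_ (beta_deriv n x hx k i hi)
    split_ifs with h
    · refine ((alpha_deriv n x k hk'.2 _ i h rfl).const_mul _).congr_deriv ?_
      ring
    · have : (fun t => (2:ℝ) ^ (i-1) * alphaF n (Function.update x k t) i) =
          fun t => (2:ℝ) ^ (i-1) * alphaF n x i := by
        funext t
        rw [alpha_upd n x k t _ i (by omega) rfl]
      rw [this]
      exact hasDerivAt_const _ _
  have := (HasDerivAt.fun_sum key).deriv
  unfold partialF Ffun
  rw [this, Finset.sum_sub_distrib, Finset.sum_ite_eq' , if_pos hk, ← Finset.sum_filter,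
    ← Finset.mul_sum]
  have e : (Finset.Icc 1 n).filter (fun i => i ≤ k) = Finset.Icc 1 k := by
    ext i; simp only [Finset.mem_filter, Finset.mem_Icc]; omega
  rw [e]; rfl

theorem stmt9 (n k : ℕ) (hk : k ∈ Finset.Icc 1 n) (x : ℕ → ℝ)
    (hx : ∀ i ∈ Finset.Icc 1 n, x i = 0 ∨ x i = 1) :
    ((0 < partialF n k x ∧ x k = 0) ∨ (partialF n k x < 0 ∧ x k = 1)) ↔
      (SameParity (Sfun n x k) (x k) ∧ Pfun n x k = 1) := by
  have hk' := Finset.mem_Icc.1 hk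
  have hx' : ∀ i, 1 ≤ i → i < k → x i = 0 ∨ x i = 1 :=
    fun i h1 h2 => hx i (Finset.mem_Icc.2 ⟨h1, by omega⟩)
  rw [partialF_eq n k hk x hx]
  have hb := abs_le.1 (WW_bound x k hk'.1 hx')
  have hpos : (0:ℝ) < 2 ^ k := by positivity
  have hpar : ∀ m m' : ℤ, (2 * m : ℝ) + 1 ≠ 2 * m' := by
    intro m m' h
    have : 2 * m + 1 = 2 * m' := by exact_mod_cast h
    omega
  rcases CC_cases n x k hk'.1 hx' with ⟨hP, hC, hW⟩ | ⟨hP, hC⟩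
  · rw [hP, hC, hW]
    unfold SameParity Sfun
    rcases alpha_par n x hx _ (k+1) (by omega) rfl with ⟨ha, m, hm⟩ | ⟨ha, m, hm⟩ <;>
    rcases hx k hk with h | h <;> rw [ha, hm, h]
    · norm_num
    · norm_num
      intro m' h'
      exact hpar m' m (by linarith)
    · norm_num
      intro m' h'
      exact hpar m m' (by linarith)
    · norm_num
  · have hC' : (2:ℝ) ^ k ≤ 2 ^ k * CC x k := le_mul_of_one_le_right hpos.le hC
    constructor
    · intro H
      exfalso
      rcases alpha_par n x hx _ (k+1) (by omega) rfl with ⟨ha, -⟩ | ⟨ha, -⟩ <;>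
      rw [ha] at H <;>
      rcases H with ⟨H, h⟩ | ⟨H, h⟩ <;> rw [h] at H <;> linarith [hb.1, hb.2]
    · intro H; exact absurd H.2 hP
end

section
/- For all n ∈ ℕ, all x ∈ {0,1}^n such that S_n(x,1) has the same parity as x_1, and all k ∈ {2,…,n}, one has P_n(x,k) = 0 or S_n(x,k) has the same parity as x_k + 1. -/
open Finset

theorem stmt12 (n : ℕ) (x : ℕ → ℝ)
    (hx : ∀ i ∈ Finset.Icc 1 n, x i = 0 ∨ x i = 1)
    (hpar : SameParity (Sfun n x 1) (x 1))
    (k : ℕ) (hk : k ∈ Finset.Icc 2 n) :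
    Pfun n x k = 0 ∨ SameParity (Sfun n x k) (x k + 1) := by
  obtain ⟨hk2, hkn⟩ := Finset.mem_Icc.mp hk
  by_cases hP : Pfun n x k = 0
  · exact Or.inl hP
  right
  obtain ⟨l, rfl⟩ : ∃ l, k = l + 2 := ⟨k - 2, by omega⟩
  have hint : ∀ i ∈ Finset.Icc 1 n, ∃ z : ℤ, x i = z := by
    intro i hi
    rcases hx i hi with h | h
    · exact ⟨0, by simp [h]⟩
    · exact ⟨1, by simp [h]⟩
  unfold Pfun at hP
  rw [if_neg (by omega)] at hP
  obtain ⟨h1, h2⟩ := mul_ne_zero_iff.mp hP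
  simp only [show l + 2 - 1 = l + 1 by omega, show l + 2 - 2 = l by omega] at h1 h2
  have hl1 : x (l + 1) = 1 :=
    (hx (l + 1) (Finset.mem_Icc.mpr ⟨by omega, by omega⟩)).resolve_left h1
  have hz : ∑ j ∈ Finset.Icc 1 l, x j = 0 := by
    apply Finset.sum_eq_zero
    intro j hj
    have h3 := Finset.prod_ne_zero_iff.mp h2 j hj
    have hj' := Finset.mem_Icc.mp hj
    rcases hx j (Finset.mem_Icc.mpr ⟨by omega, by omega⟩) with h | h
    · exact h
    · exact absurd (by rw [h]; ring) h3
  have hS : ∀ m, m + 1 ≤ n → ∑ j ∈ Finset.Icc (m + 1) n, x j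
      = x (m + 1) + ∑ j ∈ Finset.Icc (m + 2) n, x j := by
    intro m hm
    rw [← Finset.insert_Icc_add_one_left_eq_Icc hm, Finset.sum_insert (by simp), add_assoc m 1 1]
  have key : ∀ m, m ≤ n → ∑ j ∈ Finset.Icc 1 n, x j
      = ∑ j ∈ Finset.Icc 1 m, x j + ∑ j ∈ Finset.Icc (m + 1) n, x j := by
    intro m
    induction m with
    | zero => intro _; simp
    | succ m ih =>
      intro hm
      rw [ih (by omega), hS m hm, Finset.sum_Icc_succ_top (by omega)]
      ring
  have e1 := key l (by omega)
  have e2 := hS l (by omega)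
  have e3 := hS (l + 1) (by omega)
  have e4 := hS 0 (by omega)
  obtain ⟨m, hm⟩ := hpar
  obtain ⟨a, ha⟩ := hint 1 (Finset.mem_Icc.mpr ⟨le_rfl, by omega⟩)
  obtain ⟨b, hb⟩ := hint (l + 2) (Finset.mem_Icc.mpr ⟨by omega, by omega⟩)
  unfold Sfun at hm
  refine ⟨m + a - b - 1, ?_⟩
  unfold Sfun
  push_cast
  simp only [zero_add, add_assoc, Nat.reduceAdd] at *
  linarith
end

section
/- For all n ∈ ℕ, all x ∈ {0,1}^n, and all k ∈ {1,…,n} such that P_n(x,k) = 1 and S_n(x,k) has the same parity as x_k, one has ∂_k F_n(x + μ e^k) = ∂_k F_n(x) for every μ ∈ ℝ; that is, the k-th partial derivative of F_n is constant along the line through x in direction e^k. -/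
open Finset

theorem alphaF_affine (n k : ℕ) (x : ℕ → ℝ) (i : ℕ) :
    ∃ a b : ℝ, (k < i → b = 0) ∧ ∀ t, alphaF n (Function.update x k t) i = a + b * t := by
  by_cases h : n + 1 ≤ i
  · refine ⟨0, 0, fun _ => rfl, fun t => ?_⟩
    rw [alphaF]; simp [h]
  · obtain ⟨a, b, hb, hab⟩ := alphaF_affine n k x (i + 1)
    by_cases hik : i = k
    · subst hik
      have hb0 := hb (by omega)
      refine ⟨a, 1 - 2 * a, fun h => absurd h (lt_irrefl _), fun t => ?_⟩
      rw [alphaF, dif_neg h, hab, hb0, Function.update_self]; ring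
    · refine ⟨x i + (1 - 2 * x i) * a, (1 - 2 * x i) * b, fun h' => ?_, fun t => ?_⟩
      · rw [hb (by omega)]; ring
      · rw [alphaF, dif_neg h, hab, Function.update_of_ne hik]; ring
termination_by n + 1 - i
decreasing_by omega

theorem betaF_update_zero (n k : ℕ) (x : ℕ → ℝ) (hk : k ∈ Finset.Icc 1 n)
    (hx : ∀ i ∈ Finset.Icc 1 n, x i = 0 ∨ x i = 1)
    (hP : Pfun n x k = 1) (i : ℕ) (hi : i ∈ Finset.Icc 1 n) (t : ℝ) :
    betaF n (Function.update x k t) i = 0 := by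
  rw [Finset.mem_Icc] at hk
  by_cases hik : i = k
  · subst hik
    unfold Pfun at hP
    have h0 : ∀ j ∈ Finset.Icc 1 (i - 2), x j = 0 := by
      intro j hj
      have hj' := Finset.mem_Icc.mp hj
      rcases hx j (Finset.mem_Icc.mpr ⟨hj'.1, by omega⟩) with h | h
      · exact h
      · rw [Finset.prod_eq_zero hj (by rw [h]; ring)] at hP
        simp at hP
    have hprod : ∏ j ∈ Finset.Icc 1 (i - 2), (1 - x j) = 1 :=
      Finset.prod_eq_one fun j hj => by rw [h0 j hj]; ring
    rw [hprod, mul_one] at hP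
    have hsum : ∑ j ∈ Finset.Icc 1 (i - 2), Function.update x i t j = 0 := by
      refine Finset.sum_eq_zero fun j hj => ?_
      have hj' := Finset.mem_Icc.mp hj
      rw [Function.update_of_ne (by omega), h0 j hj]
    have hc : (if i = 1 then (1 : ℝ) else Function.update x i t (i - 1)) = 1 := by
      rw [Function.update_of_ne (by omega)]; exact hP
    unfold betaF
    rw [hsum, hc]; ring
  · unfold betaF
    rw [Function.update_of_ne hik]
    rcases hx i hi with h | h <;> rw [h] <;> ring

theorem stmt13 (n k : ℕ) (hk : k ∈ Finset.Icc 1 n) (x : ℕ → ℝ)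
    (hx : ∀ i ∈ Finset.Icc 1 n, x i = 0 ∨ x i = 1)
    (hP : Pfun n x k = 1) (hS : SameParity (Sfun n x k) (x k)) (μ : ℝ) :
    partialF n k (fun i => x i + μ * unitVec k i) = partialF n k x := by
  choose a b _ hab using fun i => alphaF_affine n k x i
  have key : (fun t => Ffun n (Function.update x k t)) = fun t =>
      (∑ i ∈ Finset.Icc 1 n, (2 : ℝ) ^ (i - 1) * a i)
        + (∑ i ∈ Finset.Icc 1 n, (2 : ℝ) ^ (i - 1) * b i) * t := by
    funext t
    unfold Ffun
    rw [Finset.sum_mul, ← Finset.sum_add_distrib]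
    refine Finset.sum_congr rfl fun i hi => ?_
    rw [betaF_update_zero n k x hk hx hP i hi t, hab]; ring
  have hd : ∀ c d s : ℝ, deriv (fun t : ℝ => c + d * t) s = d := by
    intro c d s
    simpa using (((hasDerivAt_id s).const_mul d).const_add c).deriv
  have hu : ∀ t, Function.update (fun i => x i + μ * unitVec k i) k t
      = Function.update x k t := by
    intro t
    funext i
    by_cases h : i = k
    · subst h; simp
    · simp [Function.update_of_ne h, unitVec, h]
  unfold partialF
  simp only [hu]
  rw [key, hd, hd]
end

section
/- For all n ∈ ℕ, all x ∈ {0,1}^n, and all k ∈ {1,…,n} such that P_n(x,k) = 1 and S_n(x,k) has the same parity as x_k, the neighboring vertex obtained by flipping the k-th coordinate has strictly larger objective value: F_n(x + (1 − 2x_k) e^k) > F_n(x). -/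
open Finset

lemma alphaF_top (n : ℕ) (x : ℕ → ℝ) (i : ℕ) (h : n + 1 ≤ i) : alphaF n x i = 0 := by
  rw [alphaF]; simp [h]

lemma alphaF_step (n : ℕ) (x : ℕ → ℝ) (i : ℕ) (h : i ≤ n) :
    alphaF n x i = x i + (1 - 2 * x i) * alphaF n x (i + 1) := by
  rw [alphaF]
  have : ¬ (n + 1 ≤ i) := by omega
  simp [this]

lemma alphaF_vert (n : ℕ) (x : ℕ → ℝ) (hx : ∀ i ∈ Finset.Icc 1 n, x i = 0 ∨ x i = 1) :
    ∀ d i : ℕ, 1 ≤ i → n + 1 - i = d → (alphaF n x i = 0 ∨ alphaF n x i = 1) ∧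
      ∃ m : ℤ, alphaF n x i - ∑ j ∈ Finset.Icc i n, x j = 2 * (m : ℝ) := by
  intro d
  induction d with
  | zero =>
    intro i h1 hd
    rw [alphaF_top n x i (by omega), Finset.Icc_eq_empty (by omega)]
    exact ⟨Or.inl rfl, 0, by simp⟩
  | succ d ih =>
    intro i h1 hd
    obtain ⟨h, m, hm⟩ := ih (i + 1) (by omega) (by omega)
    have hs : ∑ j ∈ Finset.Icc i n, x j = x i + ∑ j ∈ Finset.Icc (i + 1) n, x j := by
      rw [← Finset.insert_Icc_add_one_left_eq_Icc (show i ≤ n by omega), Finset.sum_insert (by simp)]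
    rw [alphaF_step n x i (by omega), hs]
    rcases hx i (by simp; omega) with h0 | h0 <;> rcases h with h | h <;>
      rw [h] at hm ⊢ <;> rw [h0] <;> refine ⟨by norm_num, ?_⟩
    · exact ⟨m, by linarith⟩
    · exact ⟨m, by linarith⟩
    · exact ⟨m, by linarith⟩
    · exact ⟨m - 1, by push_cast; linarith⟩

lemma alphaF_congr (n k : ℕ) (x y : ℕ → ℝ) (hy : ∀ i, i ≠ k → y i = x i) :
    ∀ d i : ℕ, k < i → n + 1 - i = d → alphaF n y i = alphaF n x i := by
  intro d
  induction d with
  | zero =>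
    intro i h1 hd
    rw [alphaF_top n x i (by omega), alphaF_top n y i (by omega)]
  | succ d ih =>
    intro i h1 hd
    rw [alphaF_step n x i (by omega), alphaF_step n y i (by omega), hy i (by omega),
      ih (i + 1) (by omega) (by omega)]

lemma alphaF_flip (n k : ℕ) (hkn : k ≤ n) (x y : ℕ → ℝ) (hy : ∀ i, i ≠ k → y i = x i)
    (hyk : y k = 1 - x k) :
    ∀ d i : ℕ, i ≤ k → k - i = d → alphaF n y i = 1 - alphaF n x i := by
  intro d
  induction d with
  | zero =>
    intro i h1 hd
    obtain rfl : i = k := by omega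
    rw [alphaF_step n x i hkn, alphaF_step n y i hkn, hyk,
      alphaF_congr n i x y hy _ (i + 1) (by omega) rfl]
    ring
  | succ d ih =>
    intro i h1 hd
    rw [alphaF_step n x i (by omega), alphaF_step n y i (by omega), hy i (by omega),
      ih (i + 1) (by omega) (by omega)]
    ring

lemma Ffun_vert (n : ℕ) (x : ℕ → ℝ) (hx : ∀ i ∈ Finset.Icc 1 n, x i = 0 ∨ x i = 1) :
    Ffun n x = ∑ i ∈ Finset.Icc 1 n, (2 : ℝ) ^ (i - 1) * alphaF n x i := by
  unfold Ffun
  refine Finset.sum_congr rfl fun i hi => ?_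
  unfold betaF
  rcases hx i hi with h | h <;> simp [h]

theorem stmt14 (n k : ℕ) (hk : k ∈ Finset.Icc 1 n) (x : ℕ → ℝ)
    (hx : ∀ i ∈ Finset.Icc 1 n, x i = 0 ∨ x i = 1)
    (hP : Pfun n x k = 1) (hS : SameParity (Sfun n x k) (x k)) :
    Ffun n (fun i => x i + (1 - 2 * x k) * unitVec k i) > Ffun n x := by
  obtain ⟨hk1, hkn⟩ := Finset.mem_Icc.mp hk
  generalize hydef : (fun i => x i + (1 - 2 * x k) * unitVec k i) = y
  have hy : ∀ i, i ≠ k → y i = x i := by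
    intro i hi; subst hydef; simp [unitVec, hi]
  have hyk : y k = 1 - x k := by
    subst hydef; simp [unitVec]; ring
  have hyv : ∀ i ∈ Finset.Icc 1 n, y i = 0 ∨ y i = 1 := by
    intro i hi
    by_cases h : i = k
    · subst h; rw [hyk]; rcases hx i hi with h | h <;> simp [h]
    · rw [hy i h]; exact hx i hi
  have hak : alphaF n x k = 0 := by
    obtain ⟨h, m, hm⟩ := alphaF_vert n x hx _ k hk1 rfl
    rcases h with h | h
    · exact h
    · exfalso
      obtain ⟨m', hm'⟩ := hS
      have hs : ∑ j ∈ Finset.Icc k n, x j = x k + ∑ j ∈ Finset.Icc (k + 1) n, x j := by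
        rw [← Finset.insert_Icc_add_one_left_eq_Icc hkn, Finset.sum_insert (by simp)]
      unfold Sfun at hm'
      rw [h, hs] at hm
      rcases hx k hk with h0 | h0 <;> rw [h0] at hm hm'
      · have : (1 : ℝ) = 2 * (m + m' : ℤ) := by push_cast; linarith
        have : (1 : ℤ) = 2 * (m + m' : ℤ) := by exact_mod_cast this
        omega
      · have : (1 : ℝ) = 2 * (m + m' + 1 : ℤ) := by push_cast; linarith
        have : (1 : ℤ) = 2 * (m + m' + 1 : ℤ) := by exact_mod_cast this
        omega
  rw [Ffun_vert n x hx, Ffun_vert n y hyv, gt_iff_lt, ← sub_pos, ← Finset.sum_sub_distrib]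
  have hlow : ∀ m, m < k → 1 - (2 : ℝ) ^ m ≤
      ∑ i ∈ Finset.Icc 1 m, ((2 : ℝ) ^ (i - 1) * alphaF n y i - 2 ^ (i - 1) * alphaF n x i) := by
    intro m
    induction m with
    | zero => intro _; simp
    | succ m ih =>
      intro hm
      rw [Finset.sum_Icc_succ_top (by omega),
        alphaF_flip n k hkn x y hy hyk _ (m + 1) (by omega) rfl]
      have := ih (by omega)
      have hp : (0 : ℝ) < 2 ^ m := by positivity
      rw [pow_succ, Nat.add_sub_cancel]
      rcases (alphaF_vert n x hx _ (m + 1) (by omega) rfl).1 with h | h <;> rw [h] <;> linarith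
  have hhigh : ∀ m, k ≤ m → (1 : ℝ) ≤
      ∑ i ∈ Finset.Icc 1 m, ((2 : ℝ) ^ (i - 1) * alphaF n y i - 2 ^ (i - 1) * alphaF n x i) := by
    intro m hm
    induction m, hm using Nat.le_induction with
    | base =>
      obtain ⟨j, rfl⟩ : ∃ j, k = j + 1 := ⟨k - 1, by omega⟩
      rw [Finset.sum_Icc_succ_top (by omega),
        alphaF_flip n (j + 1) hkn x y hy hyk _ (j + 1) le_rfl rfl, hak]
      have := hlow j (by omega)
      rw [Nat.add_sub_cancel]
      linarith
    | succ m hm ih =>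
      rw [Finset.sum_Icc_succ_top (by omega),
        alphaF_congr n k x y hy _ (m + 1) (by omega) rfl]
      linarith
  linarith [hhigh n hkn]
end

section
/- For all n ∈ ℕ with n ≥ 1, there exists a sequence x^1, x^2, …, x^{2^n} of points of {0,1}^n such that: x^1 = 0; x^{2^n} = e^n; the map i ↦ x^i is a bijection from {1,…,2^n} onto {0,1}^n; and for every i ∈ {1,…,2^n − 1} there exists k ∈ {1,…,n} with P_n(x^i,k) = 1, S_n(x^i,k) of the same parity as (x^i)_k, and x^{i+1} = x^i + (1 − 2(x^i)_k) e^k. In particular, this sequence is a Hamiltonian path in the polyhedral graph of the hypercube [0,1]^n ending in e^n. -/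
open Finset

noncomputable def gC (m j : ℕ) : ℝ := if m.testBit j = m.testBit (j+1) then 0 else 1

lemma gC_succ (m j : ℕ) : gC m (j+1) = gC (m/2) j := by
  simp [gC, Nat.testBit_succ]

lemma gC_inj (n : ℕ) : ∀ a b : ℕ, a < 2^n → b < 2^n → (∀ j < n, gC a j = gC b j) → a = b := by
  induction n with
  | zero => intro a b ha hb _; simp at ha hb; omega
  | succ n ih =>
    intro a b ha hb h
    rw [pow_succ] at ha hb
    have h2 : a / 2 = b / 2 := by
      apply ih _ _ (by omega) (by omega)
      intro j hj
      have := h (j+1) (by omega)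
      rwa [gC_succ, gC_succ] at this
    have h0 := h 0 (by omega)
    have h3 : a % 2 = b % 2 := by
      simp only [gC, Nat.testBit_succ, h2, Nat.testBit_zero] at h0
      rcases Nat.mod_two_eq_zero_or_one a with h4 | h4 <;>
      rcases Nat.mod_two_eq_zero_or_one b with h5 | h5 <;>
      rcases Nat.mod_two_eq_zero_or_one (b/2) with h6 | h6 <;> simp_all
    omega

lemma gC_surj (n : ℕ) : ∀ v : ℕ → ℝ, (∀ j < n, v j = 0 ∨ v j = 1) →
    ∃ m < 2^n, ∀ j < n, gC m j = v j := by
  induction n with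
  | zero => intro v _; exact ⟨0, by simp, by simp⟩
  | succ n ih =>
    intro v hv
    obtain ⟨m, hm, h⟩ := ih (fun j => v (j+1)) (fun j hj => hv _ (by omega))
    have key : ∃ e < 2, gC (2*m+e) 0 = v 0 := by
      have h0 : (2*m)/2 = m := by omega
      have h1 : (2*m+1)/2 = m := by omega
      rcases hv 0 (by omega) with h4 | h4 <;>
      rcases Nat.mod_two_eq_zero_or_one m with h5 | h5
      · exact ⟨0, by simp, by simp [gC, Nat.testBit_succ, h0, h4, h5]⟩
      · exact ⟨1, by simp, by simp [gC, Nat.testBit_succ, h1, h4, h5]⟩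
      · exact ⟨1, by simp, by simp [gC, Nat.testBit_succ, h1, h4, h5]⟩
      · exact ⟨0, by simp, by simp [gC, Nat.testBit_succ, h0, h4, h5]⟩
    obtain ⟨e, he, h0⟩ := key
    refine ⟨2*m+e, by rw [pow_succ]; omega, ?_⟩
    intro j hj
    cases j with
    | zero => exact h0
    | succ j =>
      rw [gC_succ, show (2*m+e)/2 = m by omega]
      exact h j (by omega)

lemma carry (n : ℕ) : ∀ m : ℕ, m + 1 < 2^n → ∃ k < n, m.testBit k = false ∧
    (m+1).testBit k = true ∧ (∀ j < k, m.testBit j = true ∧ (m+1).testBit j = false) ∧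
    ∀ j, k < j → (m+1).testBit j = m.testBit j := by
  induction n with
  | zero => intro m hm; simp at hm
  | succ n ih =>
    intro m hm
    rw [pow_succ] at hm
    rcases Nat.mod_two_eq_zero_or_one m with h | h
    · refine ⟨0, by omega, by simp [h], by simp; omega, by simp, ?_⟩
      intro j hj
      obtain ⟨j, rfl⟩ : ∃ i, j = i + 1 := ⟨j-1, by omega⟩
      rw [Nat.testBit_succ, Nat.testBit_succ, show (m+1)/2 = m/2 by omega]
    · have e : (m+1)/2 = m/2+1 := by omega
      obtain ⟨k, hk, h1, h2, h3, h4⟩ := ih (m/2) (by omega)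
      refine ⟨k+1, by omega, ?_, ?_, ?_, ?_⟩
      · rwa [Nat.testBit_succ]
      · rwa [Nat.testBit_succ, e]
      · intro j hj
        cases j with
        | zero => simp; omega
        | succ j => rw [Nat.testBit_succ, Nat.testBit_succ, e]; exact h3 j (by omega)
      · intro j hj
        obtain ⟨j, rfl⟩ : ∃ i, j = i + 1 := ⟨j-1, by omega⟩
        rw [Nat.testBit_succ, Nat.testBit_succ, e]
        exact h4 j (by omega)

lemma sum_par (n m : ℕ) (hm : m < 2^n) (d : ℕ) : ∀ k, k + d = n → ∃ z : ℤ,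
    ∑ j ∈ Finset.Icc (k+1) n, gC m (j-1) = (if m.testBit k then 1 else 0) + 2 * (z:ℝ) := by
  induction d with
  | zero =>
    intro k hk
    refine ⟨0, ?_⟩
    have : k = n := by omega
    subst this
    simp [Nat.testBit_lt_two_pow hm]
  | succ d ih =>
    intro k hk
    obtain ⟨z, hz⟩ := ih (k+1) (by omega)
    rw [← Finset.insert_Icc_add_one_left_eq_Icc (show k+1 ≤ n by omega), Finset.sum_insert (by simp), hz]
    simp only [Nat.add_sub_cancel, gC]
    cases h1 : m.testBit k <;> cases h2 : m.testBit (k+1)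
    · exact ⟨z, by simp⟩
    · exact ⟨z+1, by push_cast; simp; ring⟩
    · exact ⟨z, by simp⟩
    · exact ⟨z, by simp⟩

theorem stmt15 (n : ℕ) (hn : 1 ≤ n) :
    ∃ X : ℕ → (ℕ → ℝ),
      (∀ i ∈ Finset.Icc 1 (2 ^ n), ∀ j ∈ Finset.Icc 1 n, X i j = 0 ∨ X i j = 1) ∧
      (∀ j ∈ Finset.Icc 1 n, X 1 j = 0) ∧
      (∀ j ∈ Finset.Icc 1 n, X (2 ^ n) j = unitVec n j) ∧
      (∀ i₁ ∈ Finset.Icc 1 (2 ^ n), ∀ i₂ ∈ Finset.Icc 1 (2 ^ n),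
        (∀ j ∈ Finset.Icc 1 n, X i₁ j = X i₂ j) → i₁ = i₂) ∧
      (∀ v : ℕ → ℝ, (∀ j ∈ Finset.Icc 1 n, v j = 0 ∨ v j = 1) →
        ∃ i ∈ Finset.Icc 1 (2 ^ n), ∀ j ∈ Finset.Icc 1 n, X i j = v j) ∧
      (∀ i ∈ Finset.Icc 1 (2 ^ n - 1), ∃ k ∈ Finset.Icc 1 n,
        Pfun n (X i) k = 1 ∧ SameParity (Sfun n (X i) k) (X i k) ∧
        ∀ j ∈ Finset.Icc 1 n, X (i + 1) j = X i j + (1 - 2 * X i k) * unitVec k j) := by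
  have hp : 1 ≤ 2^n := Nat.one_le_two_pow
  refine ⟨fun i j => gC (i-1) (j-1), ?_, ?_, ?_, ?_, ?_, ?_⟩
  · intro i _ j _
    simp only [gC]
    split_ifs <;> simp
  · intro j _
    simp [gC]
  · intro j hj
    rw [Finset.mem_Icc] at hj
    simp only [gC, unitVec, Nat.testBit_two_pow_sub_one]
    by_cases h : j = n
    · simp [h]; omega
    · have h1 : j - 1 < n := by omega
      have h2 : j - 1 + 1 < n := by omega
      simp [h, h1, h2]
  · intro a ha b hb h
    rw [Finset.mem_Icc] at ha hb
    have := gC_inj n (a-1) (b-1) (by omega) (by omega) (fun j hj => by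
      simpa using h (j+1) (by rw [Finset.mem_Icc]; omega))
    omega
  · intro v hv
    obtain ⟨m, hm, h⟩ := gC_surj n (fun j => v (j+1))
      (fun j hj => hv _ (by rw [Finset.mem_Icc]; omega))
    refine ⟨m+1, by rw [Finset.mem_Icc]; omega, ?_⟩
    intro j hj
    rw [Finset.mem_Icc] at hj
    have := h (j-1) (by omega)
    simpa [show j - 1 + 1 = j by omega] using this
  · intro i hi
    rw [Finset.mem_Icc] at hi
    obtain ⟨m, rfl⟩ : ∃ m, i = m + 1 := ⟨i-1, by omega⟩
    obtain ⟨k, hk, h1, h2, h3, h4⟩ := carry n m (by omega)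
    refine ⟨k+1, by rw [Finset.mem_Icc]; omega, ?_, ?_, ?_⟩
    · simp only [Pfun, Nat.add_sub_cancel]
      rw [Finset.prod_eq_one]
      · cases k with
        | zero => simp
        | succ k => simp [gC, h1, (h3 k (by omega)).1]
      · intro j hj
        rw [Finset.mem_Icc] at hj
        simp [gC, (h3 (j-1) (by omega)).1, (h3 (j-1+1) (by omega)).1]
    · obtain ⟨z, hz⟩ := sum_par n m (by omega) (n-(k+1)) (k+1) (by omega)
      refine ⟨z, ?_⟩
      simp only [Sfun, Nat.add_sub_cancel, hz]
      simp only [gC, h1]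
      cases m.testBit (k+1) <;> simp
    · intro j hj
      rw [Finset.mem_Icc] at hj
      obtain ⟨j, rfl⟩ : ∃ i, j = i + 1 := ⟨j-1, by omega⟩
      simp only [Nat.add_sub_cancel, unitVec, gC]
      rcases lt_trichotomy j k with h | h | h
      · have hne : j ≠ k := by omega
        rcases Nat.lt_or_ge (j+1) k with h' | h'
        · simp [h3 j h, h3 (j+1) h', hne]
        · have : j + 1 = k := by omega
          subst this
          simp [h3 j h, h1, h2]
      · subst h
        rw [h1, h2, h4 (j+1) (by omega)]
        cases m.testBit (j+1) <;> norm_num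
      · have hne : j ≠ k := by omega
        simp [h4 j h, h4 (j+1) (by omega), hne]
end
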